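/- arXiv:2011.01381 — 14 statements merged into one kernel-verified Lean document; each statement's English description precedes it below -/
import Mathlib

section
/- Let f : ℝ → ℝ be convex. Then for any x ∈ ℝ and any α ∈ [0,1], the function δ ↦ α·f(x + (1−α)·δ) + (1−α)·f(x − α·δ) is monotonically non-decreasing on δ ≥ 0; that is, for all 0 ≤ δ₁ ≤ δ₂, α·f(x + (1−α)·δ₁) + (1−α)·f(x − α·δ₁) ≤ α·f(x + (1−α)·δ₂) + (1−α)·f(x − α·δ₂). -/
/-- Lemma 1 ("chords"): for a convex function `f : ℝ → ℝ`, for any `x` and `α ∈ [0,1]`,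
the map `δ ↦ α·f(x + (1−α)·δ) + (1−α)·f(x − α·δ)` is non-decreasing on `δ ≥ 0`. -/
theorem chords_lemma (f : ℝ → ℝ) (hf : ConvexOn ℝ Set.univ f)
    (x α : ℝ) (hα0 : 0 ≤ α) (hα1 : α ≤ 1)
    (δ₁ δ₂ : ℝ) (hδ1 : 0 ≤ δ₁) (hδ12 : δ₁ ≤ δ₂) :
    α * f (x + (1 - α) * δ₁) + (1 - α) * f (x - α * δ₁) ≤
      α * f (x + (1 - α) * δ₂) + (1 - α) * f (x - α * δ₂) := by
  obtain ⟨t, ht0, ht1, ht⟩ : ∃ t : ℝ, 0 ≤ t ∧ t ≤ 1 ∧ δ₁ = t * δ₂ := by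
    rcases (hδ1.trans hδ12).eq_or_lt with h | h
    · exact ⟨1, by norm_num, le_refl _, by linarith⟩
    · exact ⟨δ₁ / δ₂, by positivity, (div_le_one h).2 hδ12, by field_simp⟩
  subst ht
  have key : ∀ s a b : ℝ, 0 ≤ s → s ≤ 1 → f ((1 - s) * a + s * b) ≤ (1 - s) * f a + s * f b := by
    intro s a b h0 h1
    have := hf.2 (Set.mem_univ a) (Set.mem_univ b) (sub_nonneg.2 h1) h0 (by ring)
    simpa only [smul_eq_mul] using this
  have h1 := key t x (x + (1 - α) * δ₂) ht0 ht1
  have h2 := key t x (x - α * δ₂) ht0 ht1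
  have h3 := key α (x - α * δ₂) (x + (1 - α) * δ₂) hα0 hα1
  rw [show (1 - t) * x + t * (x + (1 - α) * δ₂) = x + (1 - α) * (t * δ₂) by ring] at h1
  rw [show (1 - t) * x + t * (x - α * δ₂) = x - α * (t * δ₂) by ring] at h2
  rw [show (1 - α) * (x - α * δ₂) + α * (x + (1 - α) * δ₂) = x by ring] at h3
  have h1' := mul_le_mul_of_nonneg_left h1 hα0
  have h2' := mul_le_mul_of_nonneg_left h2 (sub_nonneg.2 hα1)
  have h3' := mul_le_mul_of_nonneg_left h3 (sub_nonneg.2 ht1)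
  linarith
end

section
/- For every n with 1 ≤ n ≤ N+1, the function p ↦ V(n, p) is non-decreasing on [0,1]; that is, for all 0 ≤ p₁ ≤ p₂ ≤ 1, V(n, p₁) ≤ V(n, p₂). -/
/-- Proposition 1 (monotonicity in p): for every `1 ≤ n ≤ N+1`,
the function `p ↦ V(n,p)` is non-decreasing on `[0,1]`. -/
theorem value_monotone_in_p (c γ : ℝ) (hc0 : 0 < c) (hc1 : c < 1) (hγ0 : 0 < γ) (hγ1 : γ < 1)
    (N : ℕ) (hN : 1 ≤ N) (V : ℕ → ℝ → ℝ)
    (hVtop : ∀ p ∈ Set.Icc (0:ℝ) 1, V (N + 1) p = max (p - c) 0 / (1 - γ))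
    (hVrec : ∀ n : ℕ, 1 ≤ n → n ≤ N → ∀ p ∈ Set.Icc (0:ℝ) 1,
      V n p = max (p - c +
        γ * (p * V (n + 1) (((n : ℝ) * p + 1) / ((n : ℝ) + 1)) +
             (1 - p) * V (n + 1) ((n : ℝ) * p / ((n : ℝ) + 1)))) 0)
    (n : ℕ) (hn1 : 1 ≤ n) (hnN : n ≤ N + 1)
    (p₁ p₂ : ℝ) (h1 : 0 ≤ p₁) (h12 : p₁ ≤ p₂) (h2 : p₂ ≤ 1) :
    V n p₁ ≤ V n p₂ := by
  have main : ∀ k : ℕ, ∀ n : ℕ, 1 ≤ n → n + k = N + 1 → ∀ p₁ p₂ : ℝ, 0 ≤ p₁ → p₁ ≤ p₂ →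
      p₂ ≤ 1 → V n p₁ ≤ V n p₂ := by
    intro k
    induction k with
    | zero =>
      intro n _ hk p q hp hpq hq
      obtain rfl : n = N + 1 := by omega
      rw [hVtop p ⟨hp, hpq.trans hq⟩, hVtop q ⟨hp.trans hpq, hq⟩]
      have : 0 < 1 - γ := by linarith
      gcongr
    | succ k ih =>
      intro n hn hk p q hp hpq hq
      have ih' := ih (n + 1) (by omega) (by omega)
      rw [hVrec n hn (by omega) p ⟨hp, hpq.trans hq⟩,
        hVrec n hn (by omega) q ⟨hp.trans hpq, hq⟩]
      have hn0 : (0 : ℝ) ≤ n := Nat.cast_nonneg n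
      have hnp : (0 : ℝ) < (n : ℝ) + 1 := by linarith
      have hq0 : 0 ≤ q := hp.trans hpq
      have hnpq : (n : ℝ) * p ≤ n * q := mul_le_mul_of_nonneg_left hpq hn0
      have hnq : (n : ℝ) * q ≤ n := mul_le_of_le_one_right hn0 hq
      have hA := ih' (((n : ℝ) * p + 1) / ((n : ℝ) + 1)) (((n : ℝ) * q + 1) / ((n : ℝ) + 1))
        (by positivity) (by gcongr) (by rw [div_le_one hnp]; linarith)
      have hB := ih' ((n : ℝ) * p / ((n : ℝ) + 1)) ((n : ℝ) * q / ((n : ℝ) + 1))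
        (by positivity) (by gcongr) (by rw [div_le_one hnp]; linarith)
      have hAB := ih' ((n : ℝ) * q / ((n : ℝ) + 1)) (((n : ℝ) * q + 1) / ((n : ℝ) + 1))
        (by positivity) (by gcongr; linarith) (by rw [div_le_one hnp]; linarith)
      refine max_le_max ?_ le_rfl
      refine add_le_add (by linarith) (mul_le_mul_of_nonneg_left ?_ hγ0.le)
      have e1 := mul_le_mul_of_nonneg_left hA hp
      have e2 := mul_le_mul_of_nonneg_left hB (show 0 ≤ 1 - p by linarith)
      have e3 := mul_le_mul_of_nonneg_left hAB (show 0 ≤ q - p by linarith)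
      linarith
  exact main (N + 1 - n) n hn1 (by omega) p₁ p₂ h1 h12 h2
end

section
/- For every n with 1 ≤ n ≤ N+1, the function p ↦ V(n, p) is convex on [0,1]; that is, for all p₁, p₂ ∈ [0,1] and α ∈ [0,1], V(n, α·p₁ + (1−α)·p₂) ≤ α·V(n, p₁) + (1−α)·V(n, p₂). -/
/-- Increments of a convex function on `[0,1]` are nondecreasing. -/
theorem incr_mono (W : ℝ → ℝ)
    (hW : ∀ x ∈ Set.Icc (0:ℝ) 1, ∀ y ∈ Set.Icc (0:ℝ) 1, ∀ t : ℝ, 0 ≤ t → t ≤ 1 →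
      W (t * x + (1 - t) * y) ≤ t * W x + (1 - t) * W y)
    (x y d : ℝ) (hx : 0 ≤ x) (hxy : x ≤ y) (hd : 0 < d) (hy : y + d ≤ 1) :
    W (x + d) - W x ≤ W (y + d) - W y := by
  have hpos : 0 < y + d - x := by linarith
  have ht0 : 0 ≤ d / (y + d - x) := by positivity
  have ht1 : d / (y + d - x) ≤ 1 := by
    rw [div_le_one hpos]; linarith
  have hmul : d / (y + d - x) * (y + d - x) = d := div_mul_cancel₀ _ hpos.ne'
  generalize d / (y + d - x) = t at *
  have hxm : x ∈ Set.Icc (0:ℝ) 1 := ⟨hx, by linarith⟩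
  have hym : y + d ∈ Set.Icc (0:ℝ) 1 := ⟨by linarith, hy⟩
  have h1 := hW x hxm (y + d) hym t ht0 ht1
  have h2 := hW (y + d) hym x hxm t ht0 ht1
  have e1 : t * x + (1 - t) * (y + d) = y := by linarith
  have e2 : t * (y + d) + (1 - t) * x = x + d := by linarith
  rw [e1] at h1
  rw [e2] at h2
  linarith

/-- The Bernoulli updating operator preserves convexity on `[0,1]`. -/
theorem step_convex (W : ℝ → ℝ)
    (hW : ∀ x ∈ Set.Icc (0:ℝ) 1, ∀ y ∈ Set.Icc (0:ℝ) 1, ∀ t : ℝ, 0 ≤ t → t ≤ 1 →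
      W (t * x + (1 - t) * y) ≤ t * W x + (1 - t) * W y)
    (r d : ℝ) (hr : 0 ≤ r) (hd : 0 < d) (hrd : r + d = 1)
    (p q : ℝ) (hp : p ∈ Set.Icc (0:ℝ) 1) (hq : q ∈ Set.Icc (0:ℝ) 1)
    (a : ℝ) (ha0 : 0 ≤ a) (ha1 : a ≤ 1) :
    (a * p + (1 - a) * q) * W (r * (a * p + (1 - a) * q) + d)
      + (1 - (a * p + (1 - a) * q)) * W (r * (a * p + (1 - a) * q))
    ≤ a * (p * W (r * p + d) + (1 - p) * W (r * p))
      + (1 - a) * (q * W (r * q + d) + (1 - q) * W (r * q)) := by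
  obtain ⟨hp0, hp1⟩ := hp
  obtain ⟨hq0, hq1⟩ := hq
  have b0 : ∀ s : ℝ, 0 ≤ s → 0 ≤ r * s := fun s hs => mul_nonneg hr hs
  have b1 : ∀ s : ℝ, s ≤ 1 → r * s ≤ r := fun s hs => mul_le_of_le_one_right hr hs
  have hp0' := b0 p hp0
  have hq0' := b0 q hq0
  have hp1' := b1 p hp1
  have hq1' := b1 q hq1
  have h1 := hW (r * p + d) ⟨by linarith, by linarith⟩ (r * q + d) ⟨by linarith, by linarith⟩ a ha0 ha1
  have h2 := hW (r * p) ⟨by linarith, by linarith⟩ (r * q) ⟨by linarith, by linarith⟩ a ha0 ha1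
  rw [show a * (r * p + d) + (1 - a) * (r * q + d) = r * (a * p + (1 - a) * q) + d by ring] at h1
  rw [show a * (r * p) + (1 - a) * (r * q) = r * (a * p + (1 - a) * q) by ring] at h2
  have hb0 : 0 ≤ 1 - a := by linarith
  have hm0 : 0 ≤ a * p + (1 - a) * q := by positivity
  have hm1 : 0 ≤ 1 - (a * p + (1 - a) * q) := by nlinarith
  have g1 := mul_le_mul_of_nonneg_left h1 hm0
  have g2 := mul_le_mul_of_nonneg_left h2 hm1
  have key : 0 ≤ (p - q) * ((W (r * p + d) - W (r * p)) - (W (r * q + d) - W (r * q))) := by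
    rcases le_total p q with h | h
    · have := incr_mono W hW (r * p) (r * q) d hp0' (mul_le_mul_of_nonneg_left h hr) hd (by linarith)
      exact mul_nonneg_of_nonpos_of_nonpos (by linarith) (by linarith)
    · have := incr_mono W hW (r * q) (r * p) d hq0' (mul_le_mul_of_nonneg_left h hr) hd (by linarith)
      exact mul_nonneg (by linarith) (by linarith)
  have key2 := mul_nonneg (mul_nonneg ha0 hb0) key
  linarith

/-- Positive part preserves a convexity inequality. -/
theorem max_convex (x y z a : ℝ) (ha0 : 0 ≤ a) (ha1 : a ≤ 1) (h : z ≤ a * x + (1 - a) * y) :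
    max z 0 ≤ a * max x 0 + (1 - a) * max y 0 := by
  have hb0 : 0 ≤ 1 - a := by linarith
  have h1 := mul_le_mul_of_nonneg_left (le_max_left x 0) ha0
  have h2 := mul_le_mul_of_nonneg_left (le_max_left y 0) hb0
  exact max_le (by linarith) (by positivity)

/-- Proposition 1 (convexity in p): for every `1 ≤ n ≤ N+1`,
the function `p ↦ V(n,p)` is convex on `[0,1]`. -/
theorem value_convex_in_p (c γ : ℝ) (hc0 : 0 < c) (hc1 : c < 1) (hγ0 : 0 < γ) (hγ1 : γ < 1)
    (N : ℕ) (hN : 1 ≤ N) (V : ℕ → ℝ → ℝ)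
    (hVtop : ∀ p ∈ Set.Icc (0:ℝ) 1, V (N + 1) p = max (p - c) 0 / (1 - γ))
    (hVrec : ∀ n : ℕ, 1 ≤ n → n ≤ N → ∀ p ∈ Set.Icc (0:ℝ) 1,
      V n p = max (p - c +
        γ * (p * V (n + 1) (((n : ℝ) * p + 1) / ((n : ℝ) + 1)) +
             (1 - p) * V (n + 1) ((n : ℝ) * p / ((n : ℝ) + 1)))) 0)
    (n : ℕ) (hn1 : 1 ≤ n) (hnN : n ≤ N + 1)
    (p₁ p₂ : ℝ) (hp₁ : p₁ ∈ Set.Icc (0:ℝ) 1) (hp₂ : p₂ ∈ Set.Icc (0:ℝ) 1)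
    (α : ℝ) (hα0 : 0 ≤ α) (hα1 : α ≤ 1) :
    V n (α * p₁ + (1 - α) * p₂) ≤ α * V n p₁ + (1 - α) * V n p₂ := by
  have hmem : ∀ p ∈ Set.Icc (0:ℝ) 1, ∀ q ∈ Set.Icc (0:ℝ) 1, ∀ a : ℝ, 0 ≤ a → a ≤ 1 →
      a * p + (1 - a) * q ∈ Set.Icc (0:ℝ) 1 := by
    intro p hp q hq a h0 h1
    exact convex_Icc (0:ℝ) 1 hp hq h0 (by linarith) (by ring)
  have main : ∀ p ∈ Set.Icc (0:ℝ) 1, ∀ q ∈ Set.Icc (0:ℝ) 1, ∀ a : ℝ, 0 ≤ a → a ≤ 1 →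
      V n (a * p + (1 - a) * q) ≤ a * V n p + (1 - a) * V n q := by
    clear hp₁ hp₂ hα0 hα1
    induction hnN using Nat.decreasingInduction with
    | self =>
      intro p hp q hq a h0 h1
      rw [hVtop _ (hmem p hp q hq a h0 h1), hVtop p hp, hVtop q hq]
      have hg : 0 < 1 - γ := by linarith
      have h := max_convex (p - c) (q - c) (a * p + (1 - a) * q - c) a h0 h1 (by linarith)
      calc _ ≤ (a * max (p - c) 0 + (1 - a) * max (q - c) 0) / (1 - γ) := by gcongr
        _ = _ := by ring
    | of_succ k hk ih =>
      have ih := ih (by omega)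
      intro p hp q hq a h0 h1
      have hk0 : (0:ℝ) < (k:ℝ) + 1 := by positivity
      have hs := step_convex (V (k + 1)) ih ((k:ℝ) / (k + 1)) (1 / ((k:ℝ) + 1)) (by positivity)
        (by positivity) (by field_simp) p q hp hq a h0 h1
      have e1 : ∀ s : ℝ, (k:ℝ) / (k + 1) * s + 1 / ((k:ℝ) + 1) = ((k:ℝ) * s + 1) / ((k:ℝ) + 1) := by
        intro s; ring
      have e2 : ∀ s : ℝ, (k:ℝ) / (k + 1) * s = (k:ℝ) * s / ((k:ℝ) + 1) := by
        intro s; ring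
      simp only [e1] at hs
      simp only [e2] at hs
      rw [hVrec k hn1 (by omega) _ (hmem p hp q hq a h0 h1), hVrec k hn1 (by omega) p hp,
        hVrec k hn1 (by omega) q hq]
      apply max_convex _ _ _ a h0 h1
      have := mul_le_mul_of_nonneg_left hs hγ0.le
      linarith
  exact main p₁ hp₁ p₂ hp₂ α hα0 hα1
end

section
/- The value function V(n, p) is non-increasing in n: for every n with 1 ≤ n ≤ N and every p ∈ [0,1], V(n, p) ≥ V(n+1, p). -/
/-- Symmetric-pair inequality for convex functions. -/
theorem aux_pair {f : ℝ → ℝ} (hf : ConvexOn ℝ (Set.Icc 0 1) f) {u w m k : ℝ}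
    (hu : 0 ≤ u) (hw : w ≤ 1) (h1 : u ≤ m) (h2 : m ≤ w) (hk : m + k = u + w) :
    f m + f k ≤ f u + f w := by
  rcases eq_or_lt_of_le (h1.trans h2) with h | h
  · have e1 : m = u := by linarith
    have e2 : k = w := by linarith
    rw [e1, e2]
  · have hd : 0 < w - u := by linarith
    have hU : u ∈ Set.Icc (0:ℝ) 1 := ⟨hu, by linarith⟩
    have hW : w ∈ Set.Icc (0:ℝ) 1 := ⟨by linarith, hw⟩
    obtain ⟨θ, hθ⟩ : ∃ θ, θ = (m - u) / (w - u) := ⟨_, rfl⟩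
    have h0 : 0 ≤ θ := by rw [hθ]; exact div_nonneg (by linarith) hd.le
    have h1' : θ ≤ 1 := by rw [hθ, div_le_one hd]; linarith
    have hm : θ * (w - u) = m - u := by rw [hθ]; field_simp
    have A := hf.2 hU hW (sub_nonneg.2 h1') h0 (by ring)
    have B := hf.2 hU hW h0 (sub_nonneg.2 h1') (by ring)
    simp only [smul_eq_mul] at A B
    rw [show (1 - θ) * u + θ * w = m by linarith] at A
    rw [show θ * u + (1 - θ) * w = k by linarith] at B
    linarith

/-- The expectation operator preserves convexity. -/
theorem aux_convex {f : ℝ → ℝ} (hf : ConvexOn ℝ (Set.Icc 0 1) f) {b : ℝ}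
    (hb0 : 0 ≤ b) (hb1 : b ≤ 1) :
    ConvexOn ℝ (Set.Icc 0 1)
      (fun p => p * f (p + b * (1 - p)) + (1 - p) * f (p - b * p)) := by
  have mem1 : ∀ p ∈ Set.Icc (0:ℝ) 1, p + b * (1 - p) ∈ Set.Icc (0:ℝ) 1 := by
    rintro p ⟨h0, h1⟩; constructor <;> nlinarith
  have mem2 : ∀ p ∈ Set.Icc (0:ℝ) 1, p - b * p ∈ Set.Icc (0:ℝ) 1 := by
    rintro p ⟨h0, h1⟩; constructor <;> nlinarith
  have mono : ∀ x ∈ Set.Icc (0:ℝ) 1, ∀ y ∈ Set.Icc (0:ℝ) 1, x ≤ y →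
      f (x + b * (1 - x)) - f (x - b * x) ≤ f (y + b * (1 - y)) - f (y - b * y) := by
    intro x hx y hy hxy
    have := aux_pair hf (u := x - b * x) (w := y + b * (1 - y)) (m := x + b * (1 - x))
      (k := y - b * y) (mem2 x hx).1 (mem1 y hy).2 (by nlinarith) (by nlinarith) (by ring)
    linarith
  refine ⟨convex_Icc 0 1, ?_⟩
  intro x hx y hy s t hs ht hst
  have hz := (convex_Icc (0:ℝ) 1) hx hy hs ht hst
  have A := hf.2 (mem1 x hx) (mem1 y hy) hs ht hst
  have B := hf.2 (mem2 x hx) (mem2 y hy) hs ht hst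
  have hs' : s = 1 - t := by linarith
  simp only [smul_eq_mul] at A B hz ⊢
  rw [show s * (x + b * (1 - x)) + t * (y + b * (1 - y))
    = (s * x + t * y) + b * (1 - (s * x + t * y)) by subst hs'; ring] at A
  rw [show s * (x - b * x) + t * (y - b * y)
    = (s * x + t * y) - b * (s * x + t * y) by ring] at B
  have A' := mul_le_mul_of_nonneg_left A hz.1
  have B' := mul_le_mul_of_nonneg_left B (sub_nonneg.2 hz.2)
  have key : 0 ≤ (s * t) * ((y - x) * ((f (y + b * (1 - y)) - f (y - b * y))
      - (f (x + b * (1 - x)) - f (x - b * x)))) := by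
    apply mul_nonneg (mul_nonneg hs ht)
    rcases le_total x y with h | h
    · exact mul_nonneg (by linarith) (by linarith [mono x hx y hy h])
    · exact mul_nonneg_of_nonpos_of_nonpos (by linarith) (by linarith [mono y hy x hx h])
  refine (add_le_add A' B').trans ?_
  subst hs'
  linarith

/-- Jensen. -/
theorem aux_jensen {f : ℝ → ℝ} (hf : ConvexOn ℝ (Set.Icc 0 1) f) {b p : ℝ}
    (hb0 : 0 ≤ b) (hb1 : b ≤ 1) (hp : p ∈ Set.Icc (0:ℝ) 1) :
    f p ≤ p * f (p + b * (1 - p)) + (1 - p) * f (p - b * p) := by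
  obtain ⟨h0, h1⟩ := hp
  have A := hf.2 (x := p + b * (1 - p)) (y := p - b * p) ⟨by nlinarith, by nlinarith⟩
    ⟨by nlinarith, by nlinarith⟩ h0 (sub_nonneg.2 h1) (by ring)
  simp only [smul_eq_mul] at A
  rwa [show p * (p + b * (1 - p)) + (1 - p) * (p - b * p) = p by ring] at A

/-- A larger spread gives a larger expectation. -/
theorem aux_spread {f : ℝ → ℝ} (hf : ConvexOn ℝ (Set.Icc 0 1) f) {b b' p : ℝ}
    (hb0 : 0 < b) (hb1 : b ≤ 1) (hb' : 0 ≤ b') (hbb : b' ≤ b) (hp : p ∈ Set.Icc (0:ℝ) 1) :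
    p * f (p + b' * (1 - p)) + (1 - p) * f (p - b' * p) ≤
    p * f (p + b * (1 - p)) + (1 - p) * f (p - b * p) := by
  have J := aux_jensen hf hb0.le hb1 hp
  have hp' := hp
  obtain ⟨h0, h1⟩ := hp
  obtain ⟨l, hl⟩ : ∃ l, l = b' / b := ⟨_, rfl⟩
  have hl0 : 0 ≤ l := by rw [hl]; positivity
  have hl1 : l ≤ 1 := by rw [hl, div_le_one hb0]; exact hbb
  have hlb : b' = l * b := by rw [hl]; field_simp
  have A := hf.2 (x := p + b * (1 - p)) (y := p) ⟨by nlinarith, by nlinarith⟩ hp'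
    hl0 (sub_nonneg.2 hl1) (by ring)
  have B := hf.2 (x := p - b * p) (y := p) ⟨by nlinarith, by nlinarith⟩ hp'
    hl0 (sub_nonneg.2 hl1) (by ring)
  simp only [smul_eq_mul] at A B
  rw [show l * (p + b * (1 - p)) + (1 - l) * p = p + b' * (1 - p) by rw [hlb]; ring] at A
  rw [show l * (p - b * p) + (1 - l) * p = p - b' * p by rw [hlb]; ring] at B
  have A' := mul_le_mul_of_nonneg_left A h0
  have B' := mul_le_mul_of_nonneg_left B (sub_nonneg.2 h1)
  have J' := mul_le_mul_of_nonneg_left J (sub_nonneg.2 hl1)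
  linarith

/-- Proposition 2 (monotonicity in n): for every `1 ≤ n ≤ N` and `p ∈ [0,1]`,
`V(n,p) ≥ V(n+1,p)`. -/
theorem value_nonincreasing_in_n (c γ : ℝ) (hc0 : 0 < c) (hc1 : c < 1) (hγ0 : 0 < γ) (hγ1 : γ < 1)
    (N : ℕ) (hN : 1 ≤ N) (V : ℕ → ℝ → ℝ)
    (hVtop : ∀ p ∈ Set.Icc (0:ℝ) 1, V (N + 1) p = max (p - c) 0 / (1 - γ))
    (hVrec : ∀ n : ℕ, 1 ≤ n → n ≤ N → ∀ p ∈ Set.Icc (0:ℝ) 1,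
      V n p = max (p - c +
        γ * (p * V (n + 1) (((n : ℝ) * p + 1) / ((n : ℝ) + 1)) +
             (1 - p) * V (n + 1) ((n : ℝ) * p / ((n : ℝ) + 1)))) 0)
    (n : ℕ) (hn1 : 1 ≤ n) (hnN : n ≤ N) (p : ℝ) (hp : p ∈ Set.Icc (0:ℝ) 1) :
    V n p ≥ V (n + 1) p := by
  have hg : 0 < 1 - γ := by linarith
  have hrec : ∀ n : ℕ, 1 ≤ n → n ≤ N → ∀ p ∈ Set.Icc (0:ℝ) 1,
      V n p = max (p - c + γ * (p * V (n + 1) (p + (1 / ((n:ℝ) + 1)) * (1 - p)) +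
        (1 - p) * V (n + 1) (p - (1 / ((n:ℝ) + 1)) * p))) 0 := by
    intro n h1 h2 p hp
    rw [hVrec n h1 h2 p hp]
    have hn : (n:ℝ) + 1 ≠ 0 := by positivity
    rw [show p + (1 / ((n:ℝ) + 1)) * (1 - p) = ((n : ℝ) * p + 1) / ((n : ℝ) + 1) by
        field_simp; ring,
      show p - (1 / ((n:ℝ) + 1)) * p = (n : ℝ) * p / ((n : ℝ) + 1) by field_simp; ring]
  have hb0 : ∀ n : ℕ, 0 < 1 / ((n:ℝ) + 1) := fun n => by positivity
  have hb1 : ∀ n : ℕ, 1 / ((n:ℝ) + 1) ≤ 1 := fun n => by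
    rw [div_le_one (by positivity)]; linarith [Nat.cast_nonneg (α := ℝ) n]
  have hlin : ConvexOn ℝ (Set.Icc (0:ℝ) 1) (fun p => p - c) :=
    (convexOn_id (convex_Icc 0 1)).sub (concaveOn_const c (convex_Icc 0 1))
  have hzero : ConvexOn ℝ (Set.Icc (0:ℝ) 1) (fun _ => (0:ℝ)) :=
    convexOn_const 0 (convex_Icc 0 1)
  have hconv : ∀ k n : ℕ, 1 ≤ n → n + k = N + 1 → ConvexOn ℝ (Set.Icc (0:ℝ) 1) (V n) := by
    intro k
    induction k with
    | zero =>
      intro n _ h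
      obtain rfl : n = N + 1 := by omega
      refine ((hlin.sup hzero).smul (inv_nonneg.2 hg.le)).congr ?_
      intro p hp
      rw [hVtop p hp]
      simp [div_eq_inv_mul]
    | succ k ih =>
      intro n h1 h
      have C := aux_convex (ih (n + 1) (by omega) (by omega)) (hb0 n).le (hb1 n)
      refine ((hlin.add (C.smul hγ0.le)).sup hzero).congr ?_
      intro p hp
      rw [hrec n h1 (by omega) p hp]
      simp
  have main : ∀ k n : ℕ, 1 ≤ n → n + k = N → ∀ p ∈ Set.Icc (0:ℝ) 1, V (n + 1) p ≤ V n p := by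
    intro k
    induction k with
    | zero =>
      intro n h1 h p hp
      obtain rfl : n = N := by omega
      have J := aux_jensen (hconv 0 (n + 1) (by omega) rfl) (hb0 n).le (hb1 n) hp
      have J' := mul_le_mul_of_nonneg_left J hγ0.le
      have T := hVtop p hp
      rw [hrec n h1 le_rfl p hp]
      rcases le_total (p - c) 0 with h | h
      · rw [max_eq_right h, zero_div] at T
        rw [T]; exact le_max_right _ _
      · rw [max_eq_left h, eq_div_iff hg.ne'] at T
        refine le_trans ?_ (le_max_left _ _)
        linarith
    | succ k ih =>
      intro n h1 h p hp
      have S := aux_spread (hconv (k + 1) (n + 1) (by omega) (by omega)) (hb0 n) (hb1 n)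
        (hb0 (n + 1)).le
        (one_div_le_one_div_of_le (by positivity) (by push_cast; linarith)) hp
      rw [hrec n h1 (by omega) p hp, hrec (n + 1) (by omega) (by omega) p hp]
      have I := ih (n + 1) (by omega) (by omega)
      have b0 := hb0 (n + 1)
      have b1 := hb1 (n + 1)
      generalize 1 / (((n + 1 : ℕ):ℝ) + 1) = b at *
      obtain ⟨h0, h1⟩ := hp
      have I1 := mul_le_mul_of_nonneg_left
        (I (p + b * (1 - p)) ⟨by nlinarith, by nlinarith⟩) h0
      have I2 := mul_le_mul_of_nonneg_left
        (I (p - b * p) ⟨by nlinarith, by nlinarith⟩) (sub_nonneg.2 h1)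
      refine max_le_max ?_ le_rfl
      have := mul_le_mul_of_nonneg_left ((add_le_add I1 I2).trans S) hγ0.le
      linarith
  exact main (N - n) n hn1 (by omega) p hp
end

section
/- For every n with 1 ≤ n ≤ N+1 and every p ∈ [0,1], the value function satisfies the lower bound V(n, p) ≥ max{p − c, 0}/(1 − γ). In particular V(n, p) > 0 whenever p > c. -/
/-- Lower bound: for every `1 ≤ n ≤ N+1` and `p ∈ [0,1]`,
`V(n,p) ≥ max{p − c, 0}/(1 − γ)`; in particular `V(n,p) > 0` whenever `p > c`. -/
theorem value_lower_bound (c γ : ℝ) (hc0 : 0 < c) (hc1 : c < 1) (hγ0 : 0 < γ) (hγ1 : γ < 1)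
    (N : ℕ) (hN : 1 ≤ N) (V : ℕ → ℝ → ℝ)
    (hVtop : ∀ p ∈ Set.Icc (0:ℝ) 1, V (N + 1) p = max (p - c) 0 / (1 - γ))
    (hVrec : ∀ n : ℕ, 1 ≤ n → n ≤ N → ∀ p ∈ Set.Icc (0:ℝ) 1,
      V n p = max (p - c +
        γ * (p * V (n + 1) (((n : ℝ) * p + 1) / ((n : ℝ) + 1)) +
             (1 - p) * V (n + 1) ((n : ℝ) * p / ((n : ℝ) + 1)))) 0)
    (n : ℕ) (hn1 : 1 ≤ n) (hnN : n ≤ N + 1) (p : ℝ) (hp : p ∈ Set.Icc (0:ℝ) 1) :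
    V n p ≥ max (p - c) 0 / (1 - γ) ∧ (c < p → 0 < V n p) := by
  have h1γ : 0 < 1 - γ := by linarith
  have key : ∀ k m : ℕ, 1 ≤ m → m + k = N + 1 → ∀ q ∈ Set.Icc (0:ℝ) 1,
      V m q ≥ max (q - c) 0 / (1 - γ) := by
    intro k
    induction k with
    | zero =>
      intro m _ hmk q hq
      have hm : m = N + 1 := by omega
      subst hm
      exact (hVtop q hq).ge
    | succ k ih =>
      intro m hm hmk q hq
      obtain ⟨hq0, hq1⟩ := hq
      have hm0 : (0:ℝ) < (m:ℝ) + 1 := by positivity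
      have hmn : (0:ℝ) ≤ (m:ℝ) := by positivity
      have hmq : (m:ℝ) * q ≤ m := mul_le_of_le_one_right hmn hq1
      have ha := ih (m + 1) (by omega) (by omega) (((m : ℝ) * q + 1) / ((m : ℝ) + 1))
        ⟨by positivity, by rw [div_le_one hm0]; linarith⟩
      have hb := ih (m + 1) (by omega) (by omega) ((m : ℝ) * q / ((m : ℝ) + 1))
        ⟨by positivity, by rw [div_le_one hm0]; linarith⟩
      have hlow : ∀ x : ℝ, (x - c) / (1 - γ) ≤ max (x - c) 0 / (1 - γ) := fun x =>
        div_le_div_of_nonneg_right (le_max_left _ _) h1γ.le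
      have ha' := mul_le_mul_of_nonneg_left ((hlow _).trans ha) hq0
      have hb' := mul_le_mul_of_nonneg_left ((hlow _).trans hb) (sub_nonneg.2 hq1)
      have hs := mul_le_mul_of_nonneg_left (add_le_add ha' hb') hγ0.le
      have heq : q - c + γ * (q * ((((m : ℝ) * q + 1) / ((m : ℝ) + 1) - c) / (1 - γ)) +
          (1 - q) * (((m : ℝ) * q / ((m : ℝ) + 1) - c) / (1 - γ))) = (q - c) / (1 - γ) := by
        have := h1γ.ne'
        field_simp
        ring
      rw [hVrec m hm (by omega) q ⟨hq0, hq1⟩, ge_iff_le]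
      rcases le_total (q - c) 0 with h | h
      · rw [max_eq_right h, zero_div]
        exact le_max_right _ _
      · rw [max_eq_left h]
        refine le_trans ?_ (le_max_left _ _)
        linarith
  have h := key (N + 1 - n) n hn1 (by omega) p hp
  refine ⟨h, fun hcp => lt_of_lt_of_le ?_ h⟩
  exact div_pos (lt_max_of_lt_left (sub_pos.2 hcp)) h1γ
end

section
/- Let g : [0,1] → ℝ be non-decreasing and convex, and let n ≥ 1 be a natural number. Then the function p ↦ p·g((n·p + 1)/(n+1)) + (1 − p)·g(n·p/(n+1)) is non-decreasing on [0,1]; that is, for all 0 ≤ p₁ ≤ p₂ ≤ 1, p₁·g((n·p₁+1)/(n+1)) + (1−p₁)·g(n·p₁/(n+1)) ≤ p₂·g((n·p₂+1)/(n+1)) + (1−p₂)·g(n·p₂/(n+1)). -/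
/-- If `g : [0,1] → ℝ` is non-decreasing and convex and `n ≥ 1`, then
`p ↦ p·g((n·p + 1)/(n+1)) + (1 − p)·g(n·p/(n+1))` is non-decreasing on `[0,1]`. -/
theorem vbar_monotone (g : ℝ → ℝ)
    (hg_mono : MonotoneOn g (Set.Icc (0:ℝ) 1))
    (hg_conv : ConvexOn ℝ (Set.Icc (0:ℝ) 1) g)
    (n : ℕ) (hn : 1 ≤ n)
    (p₁ p₂ : ℝ) (h1 : 0 ≤ p₁) (h12 : p₁ ≤ p₂) (h2 : p₂ ≤ 1) :
    p₁ * g (((n : ℝ) * p₁ + 1) / ((n : ℝ) + 1)) + (1 - p₁) * g ((n : ℝ) * p₁ / ((n : ℝ) + 1)) ≤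
      p₂ * g (((n : ℝ) * p₂ + 1) / ((n : ℝ) + 1)) + (1 - p₂) * g ((n : ℝ) * p₂ / ((n : ℝ) + 1)) := by
  have hn0 : (0:ℝ) ≤ (n:ℝ) := Nat.cast_nonneg n
  have hpos : (0:ℝ) < (n:ℝ) + 1 := by linarith
  have a1 : 0 ≤ (n:ℝ) * p₁ := mul_nonneg hn0 h1
  have a2 : (n:ℝ) * p₁ ≤ (n:ℝ) * p₂ := mul_le_mul_of_nonneg_left h12 hn0
  have a3 : (n:ℝ) * p₂ ≤ (n:ℝ) := by nlinarith
  have key : ∀ x y : ℝ, 0 ≤ x → x ≤ y → y ≤ (n:ℝ) + 1 →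
      g (x / ((n:ℝ) + 1)) ≤ g (y / ((n:ℝ) + 1)) := by
    intro x y hx hxy hy
    apply hg_mono
    · exact ⟨div_nonneg hx hpos.le, (div_le_one hpos).2 (hxy.trans hy)⟩
    · exact ⟨div_nonneg (hx.trans hxy) hpos.le, (div_le_one hpos).2 hy⟩
    · exact div_le_div_of_nonneg_right hxy hpos.le
  have k1 := key ((n:ℝ) * p₁ + 1) ((n:ℝ) * p₂ + 1) (by linarith) (by linarith) (by linarith)
  have k2 := key ((n:ℝ) * p₁) ((n:ℝ) * p₂) (by linarith) (by linarith) (by linarith)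
  have k3 := key ((n:ℝ) * p₂) ((n:ℝ) * p₂ + 1) (by linarith) (by linarith) (by linarith)
  have m1 := mul_le_mul_of_nonneg_left k1 h1
  have m2 := mul_le_mul_of_nonneg_left k2 (show 0 ≤ 1 - p₁ by linarith)
  have m3 := mul_le_mul_of_nonneg_left k3 (show 0 ≤ p₂ - p₁ by linarith)
  linarith
end

section
/- Let g : [0,1] → ℝ be convex and let n ≥ 1 be a natural number. Then the function p ↦ p·g((n·p + 1)/(n+1)) + (1 − p)·g(n·p/(n+1)) is convex on [0,1]; that is, for all p₁, p₂ ∈ [0,1] and α ∈ [0,1], writing q = α·p₁ + (1−α)·p₂, one has q·g((n·q+1)/(n+1)) + (1−q)·g(n·q/(n+1)) ≤ α·[p₁·g((n·p₁+1)/(n+1)) + (1−p₁)·g(n·p₁/(n+1))] + (1−α)·[p₂·g((n·p₂+1)/(n+1)) + (1−p₂)·g(n·p₂/(n+1))]. -/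
/-- Increments of a convex function over a fixed step are monotone. -/
theorem convex_incr_mono (g : ℝ → ℝ) (hg : ConvexOn ℝ (Set.Icc (0:ℝ) 1) g)
    (x y h : ℝ) (hx : 0 ≤ x) (hxy : x ≤ y) (hh : 0 < h) (hy : y + h ≤ 1) :
    g (x + h) - g x ≤ g (y + h) - g y := by
  have hd : 0 < y - x + h := by linarith
  have hX : x ∈ Set.Icc (0:ℝ) 1 := ⟨hx, by linarith⟩
  have hY : y + h ∈ Set.Icc (0:ℝ) 1 := ⟨by linarith, hy⟩
  have ha : 0 ≤ (y - x) / (y - x + h) := div_nonneg (by linarith) hd.le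
  have hb : 0 ≤ h / (y - x + h) := div_nonneg hh.le hd.le
  have hab : (y - x) / (y - x + h) + h / (y - x + h) = 1 := by
    rw [← add_div, div_self hd.ne']
  have h1 := hg.2 hX hY ha hb hab
  have h2 := hg.2 hX hY hb ha (by rw [add_comm]; exact hab)
  simp only [smul_eq_mul] at h1 h2
  have e1 : (y - x) / (y - x + h) * x + h / (y - x + h) * (y + h) = x + h := by
    field_simp
    ring
  have e2 : h / (y - x + h) * x + (y - x) / (y - x + h) * (y + h) = y := by
    field_simp
    ring
  rw [e1] at h1
  rw [e2] at h2
  have e3 : ((y - x) / (y - x + h) + h / (y - x + h)) * (g x + g (y + h))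
      = g x + g (y + h) := by rw [hab, one_mul]
  linarith

/-- If `g : [0,1] → ℝ` is convex and `n ≥ 1`, then
`p ↦ p·g((n·p + 1)/(n+1)) + (1 − p)·g(n·p/(n+1))` is convex on `[0,1]`. -/
theorem vbar_convex (g : ℝ → ℝ)
    (hg_conv : ConvexOn ℝ (Set.Icc (0:ℝ) 1) g)
    (n : ℕ) (hn : 1 ≤ n)
    (p₁ p₂ : ℝ) (hp₁ : p₁ ∈ Set.Icc (0:ℝ) 1) (hp₂ : p₂ ∈ Set.Icc (0:ℝ) 1)
    (α : ℝ) (hα0 : 0 ≤ α) (hα1 : α ≤ 1) :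
    (α * p₁ + (1 - α) * p₂) *
        g (((n : ℝ) * (α * p₁ + (1 - α) * p₂) + 1) / ((n : ℝ) + 1)) +
      (1 - (α * p₁ + (1 - α) * p₂)) *
        g ((n : ℝ) * (α * p₁ + (1 - α) * p₂) / ((n : ℝ) + 1)) ≤
    α * (p₁ * g (((n : ℝ) * p₁ + 1) / ((n : ℝ) + 1)) +
          (1 - p₁) * g ((n : ℝ) * p₁ / ((n : ℝ) + 1))) +
      (1 - α) * (p₂ * g (((n : ℝ) * p₂ + 1) / ((n : ℝ) + 1)) +
          (1 - p₂) * g ((n : ℝ) * p₂ / ((n : ℝ) + 1))) := by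
  have hN : (0:ℝ) < (n:ℝ) + 1 := by positivity
  have hn0 : (0:ℝ) ≤ (n:ℝ) := by positivity
  have mA : ∀ p ∈ Set.Icc (0:ℝ) 1, (n:ℝ) * p / ((n:ℝ) + 1) ∈ Set.Icc (0:ℝ) 1 := by
    rintro p ⟨h0, h1⟩
    refine ⟨by positivity, ?_⟩
    rw [div_le_one hN]
    nlinarith
  have mB : ∀ p ∈ Set.Icc (0:ℝ) 1, ((n:ℝ) * p + 1) / ((n:ℝ) + 1) ∈ Set.Icc (0:ℝ) 1 := by
    rintro p ⟨h0, h1⟩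
    refine ⟨by positivity, ?_⟩
    rw [div_le_one hN]
    nlinarith
  have mD : ∀ p ∈ Set.Icc (0:ℝ) 1, ∀ r ∈ Set.Icc (0:ℝ) 1, p ≤ r →
      g (((n:ℝ) * p + 1) / ((n:ℝ) + 1)) - g ((n:ℝ) * p / ((n:ℝ) + 1)) ≤
      g (((n:ℝ) * r + 1) / ((n:ℝ) + 1)) - g ((n:ℝ) * r / ((n:ℝ) + 1)) := by
    intro p hp r hr hpr
    have hr1 := (mB r hr).2
    rw [add_div] at hr1
    rw [add_div, add_div]
    exact convex_incr_mono g hg_conv _ _ _ (mA p hp).1 (by gcongr) (by positivity) hr1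
  have hβ : 0 ≤ 1 - α := by linarith
  have cA := hg_conv.2 (mA p₁ hp₁) (mA p₂ hp₂) hα0 hβ (by ring)
  have cB := hg_conv.2 (mB p₁ hp₁) (mB p₂ hp₂) hα0 hβ (by ring)
  simp only [smul_eq_mul] at cA cB
  have eA : α * ((n:ℝ) * p₁ / ((n:ℝ) + 1)) + (1 - α) * ((n:ℝ) * p₂ / ((n:ℝ) + 1))
      = (n : ℝ) * (α * p₁ + (1 - α) * p₂) / ((n : ℝ) + 1) := by ring
  have eB : α * (((n:ℝ) * p₁ + 1) / ((n:ℝ) + 1)) + (1 - α) * (((n:ℝ) * p₂ + 1) / ((n:ℝ) + 1))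
      = ((n : ℝ) * (α * p₁ + (1 - α) * p₂) + 1) / ((n : ℝ) + 1) := by ring
  rw [eA] at cA
  rw [eB] at cB
  have hcov : 0 ≤ (p₁ - p₂) *
      ((g (((n:ℝ) * p₁ + 1) / ((n:ℝ) + 1)) - g ((n:ℝ) * p₁ / ((n:ℝ) + 1))) -
      (g (((n:ℝ) * p₂ + 1) / ((n:ℝ) + 1)) - g ((n:ℝ) * p₂ / ((n:ℝ) + 1)))) := by
    rcases le_total p₁ p₂ with h | h
    · exact mul_nonneg_of_nonpos_of_nonpos (by linarith)
        (by linarith [mD p₁ hp₁ p₂ hp₂ h])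
    · exact mul_nonneg (by linarith) (by linarith [mD p₂ hp₂ p₁ hp₁ h])
  have hq := convex_Icc (0:ℝ) 1 hp₁ hp₂ hα0 hβ (by ring)
  simp only [smul_eq_mul] at hq
  have k1 := mul_le_mul_of_nonneg_left cB hq.1
  have k2 := mul_le_mul_of_nonneg_left cA (sub_nonneg.2 hq.2)
  have k3 := mul_nonneg (mul_nonneg hα0 hβ) hcov
  refine (add_le_add k1 k2).trans ?_
  rw [← sub_nonneg]
  refine k3.trans (le_of_eq ?_)
  generalize g (((n:ℝ) * p₁ + 1) / ((n:ℝ) + 1)) = B1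
  generalize g (((n:ℝ) * p₂ + 1) / ((n:ℝ) + 1)) = B2
  generalize g ((n:ℝ) * p₁ / ((n:ℝ) + 1)) = A1
  generalize g ((n:ℝ) * p₂ / ((n:ℝ) + 1)) = A2
  ring
end

section
/- Let g : [0,1] → ℝ be convex, let n ≥ 1 be a natural number, and let p ∈ [0,1]. Then p·g(p + (1−p)/n) + (1−p)·g(p − p/n) ≥ p·g(p + (1−p)/(n+1)) + (1−p)·g(p − p/(n+1)). -/
/-- If `g : [0,1] → ℝ` is convex, `n ≥ 1`, and `p ∈ [0,1]`, then
`p·g(p + (1−p)/n) + (1−p)·g(p − p/n) ≥ p·g(p + (1−p)/(n+1)) + (1−p)·g(p − p/(n+1))`. -/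
theorem spread_monotone (g : ℝ → ℝ)
    (hg : ConvexOn ℝ (Set.Icc (0:ℝ) 1) g)
    (n : ℕ) (hn : 1 ≤ n)
    (p : ℝ) (hp : p ∈ Set.Icc (0:ℝ) 1) :
    p * g (p + (1 - p) / (n : ℝ)) + (1 - p) * g (p - p / (n : ℝ)) ≥
      p * g (p + (1 - p) / ((n : ℝ) + 1)) + (1 - p) * g (p - p / ((n : ℝ) + 1)) := by
  obtain ⟨hp0, hp1⟩ := hp
  have hN : (1:ℝ) ≤ (n:ℝ) := by exact_mod_cast hn
  generalize (n:ℝ) = N at hN ⊢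
  have hN0 : 0 < N := by linarith
  have hN1 : 0 < N + 1 := by linarith
  have a1 : (1 - p) / N ≤ 1 - p := div_le_self (by linarith) hN
  have a0 : 0 ≤ (1 - p) / N := div_nonneg (by linarith) hN0.le
  have b1 : p / N ≤ p := div_le_self hp0 hN
  have b0 : 0 ≤ p / N := div_nonneg hp0 hN0.le
  have hA : p + (1 - p) / N ∈ Set.Icc (0:ℝ) 1 := ⟨by linarith, by linarith⟩
  have hB : p - p / N ∈ Set.Icc (0:ℝ) 1 := ⟨by linarith, by linarith⟩
  have hP : p ∈ Set.Icc (0:ℝ) 1 := ⟨hp0, hp1⟩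
  have ht0 : 0 ≤ N / (N + 1) := by positivity
  have hs0 : 0 ≤ 1 / (N + 1) := by positivity
  have hts : N / (N + 1) + 1 / (N + 1) = 1 := by field_simp
  have h1 := hg.2 hA hP ht0 hs0 hts
  have h2 := hg.2 hB hP ht0 hs0 hts
  have h3 := hg.2 hA hB hp0 (sub_nonneg.2 hp1) (by ring)
  simp only [smul_eq_mul] at h1 h2 h3
  have e1 : N / (N + 1) * (p + (1 - p) / N) + 1 / (N + 1) * p = p + (1 - p) / (N + 1) := by
    field_simp
    ring
  have e2 : N / (N + 1) * (p - p / N) + 1 / (N + 1) * p = p - p / (N + 1) := by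
    field_simp
    ring
  have e3 : p * (p + (1 - p) / N) + (1 - p) * (p - p / N) = p := by
    field_simp
    ring
  rw [e1] at h1
  rw [e2] at h2
  rw [e3] at h3
  have k1 := mul_le_mul_of_nonneg_left h1 hp0
  have k2 := mul_le_mul_of_nonneg_left h2 (sub_nonneg.2 hp1)
  have k3 := mul_le_mul_of_nonneg_left h3 hs0
  have ht : N / (N + 1) = 1 - 1 / (N + 1) := by linarith
  rw [ht] at k1 k2
  linarith
end

section
/- Let p ∈ [0,1] satisfy (N·p + 1)/(N+1) ≤ c. Then V(N, p) = 0, which equals V(N+1, p) = max{p − c, 0}/(1 − γ) since p ≤ c in this case. -/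
/-- Base case, first regime: if `p ∈ [0,1]` and `(N·p+1)/(N+1) ≤ c`, then
`V(N,p) = 0`, which equals `V(N+1,p) = max{p−c,0}/(1−γ)` since `p ≤ c`. -/
theorem base_case_low (c γ : ℝ) (hc0 : 0 < c) (hc1 : c < 1) (hγ0 : 0 < γ) (hγ1 : γ < 1)
    (N : ℕ) (hN : 1 ≤ N) (V : ℕ → ℝ → ℝ)
    (hVtop : ∀ p ∈ Set.Icc (0:ℝ) 1, V (N + 1) p = max (p - c) 0 / (1 - γ))
    (hVrec : ∀ n : ℕ, 1 ≤ n → n ≤ N → ∀ p ∈ Set.Icc (0:ℝ) 1,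
      V n p = max (p - c +
        γ * (p * V (n + 1) (((n : ℝ) * p + 1) / ((n : ℝ) + 1)) +
             (1 - p) * V (n + 1) ((n : ℝ) * p / ((n : ℝ) + 1)))) 0)
    (p : ℝ) (hp : p ∈ Set.Icc (0:ℝ) 1)
    (hcase : ((N : ℝ) * p + 1) / ((N : ℝ) + 1) ≤ c) :
    V N p = 0 ∧ p ≤ c ∧ V N p = V (N + 1) p := by
  obtain ⟨hp0, hp1⟩ := hp
  have hN0 : (0:ℝ) ≤ N := Nat.cast_nonneg N
  have hN1 : (0:ℝ) < (N:ℝ) + 1 := by linarith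
  have hNp : 0 ≤ (N:ℝ) * p := mul_nonneg hN0 hp0
  have hup : ((N:ℝ) * p + 1) / ((N:ℝ) + 1) ∈ Set.Icc (0:ℝ) 1 :=
    ⟨by positivity, by linarith⟩
  have hle : (N:ℝ) * p / ((N:ℝ) + 1) ≤ ((N:ℝ) * p + 1) / ((N:ℝ) + 1) := by
    gcongr
    linarith
  have hdn : (N:ℝ) * p / ((N:ℝ) + 1) ∈ Set.Icc (0:ℝ) 1 :=
    ⟨by positivity, by linarith⟩
  have hpc : p ≤ c := by
    refine le_trans ?_ hcase
    rw [le_div_iff₀ hN1]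
    linarith
  have hz : ∀ q ∈ Set.Icc (0:ℝ) 1, q ≤ c → V (N + 1) q = 0 := by
    intro q hq hqc
    rw [hVtop q hq, max_eq_right (by linarith), zero_div]
  have h0 : V N p = 0 := by
    rw [hVrec N hN le_rfl p ⟨hp0, hp1⟩, hz _ hup hcase, hz _ hdn (hle.trans hcase)]
    apply max_eq_right
    linarith
  exact ⟨h0, hpc, by rw [h0, hz p ⟨hp0, hp1⟩ hpc]⟩
end

section
/- Let p ∈ [0,1] satisfy N·p/(N+1) > c. Then V(N, p) = (p − c)/(1 − γ), which equals V(N+1, p) since p > c in this case. -/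
/-- Base case, third regime: if `p ∈ [0,1]` and `N·p/(N+1) > c`, then
`V(N,p) = (p − c)/(1 − γ)`, which equals `V(N+1,p)` since `p > c`. -/
theorem base_case_high (c γ : ℝ) (hc0 : 0 < c) (hc1 : c < 1) (hγ0 : 0 < γ) (hγ1 : γ < 1)
    (N : ℕ) (hN : 1 ≤ N) (V : ℕ → ℝ → ℝ)
    (hVtop : ∀ p ∈ Set.Icc (0:ℝ) 1, V (N + 1) p = max (p - c) 0 / (1 - γ))
    (hVrec : ∀ n : ℕ, 1 ≤ n → n ≤ N → ∀ p ∈ Set.Icc (0:ℝ) 1,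
      V n p = max (p - c +
        γ * (p * V (n + 1) (((n : ℝ) * p + 1) / ((n : ℝ) + 1)) +
             (1 - p) * V (n + 1) ((n : ℝ) * p / ((n : ℝ) + 1)))) 0)
    (p : ℝ) (hp : p ∈ Set.Icc (0:ℝ) 1)
    (hcase : c < (N : ℝ) * p / ((N : ℝ) + 1)) :
    V N p = (p - c) / (1 - γ) ∧ c < p ∧ V N p = V (N + 1) p := by
  obtain ⟨h0, h1⟩ := hp
  have hn : (0:ℝ) ≤ (N:ℝ) := Nat.cast_nonneg N
  have hn1 : (0:ℝ) < (N:ℝ) + 1 := by linarith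
  have hg : (0:ℝ) < 1 - γ := by linarith
  have hnp : (N:ℝ) * p ≤ N := by nlinarith
  have hnp0 : 0 ≤ (N:ℝ) * p := mul_nonneg hn h0
  have hlow : (N:ℝ) * p / ((N:ℝ) + 1) ≤ p := by
    rw [div_le_iff₀ hn1]; nlinarith
  have hhigh : (N:ℝ) * p / ((N:ℝ) + 1) ≤ ((N:ℝ) * p + 1) / ((N:ℝ) + 1) := by
    gcongr; linarith
  have hhigh1 : ((N:ℝ) * p + 1) / ((N:ℝ) + 1) ≤ 1 := by
    rw [div_le_one hn1]; linarith
  have hcp : c < p := by linarith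
  have key : V N p = (p - c) / (1 - γ) := by
    rw [hVrec N hN le_rfl p ⟨h0, h1⟩, hVtop _ ⟨by linarith, hhigh1⟩,
      hVtop _ ⟨by linarith, by linarith⟩, max_eq_left (a := _ - c) (by linarith),
      max_eq_left (a := (N:ℝ) * p / ((N:ℝ) + 1) - c) (by linarith)]
    have e : p - c + γ * (p * ((((N:ℝ) * p + 1) / ((N:ℝ) + 1) - c) / (1 - γ)) +
        (1 - p) * (((N:ℝ) * p / ((N:ℝ) + 1) - c) / (1 - γ))) = (p - c) / (1 - γ) := by
      have := hn1.ne'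
      have := hg.ne'
      field_simp
      ring
    rw [e]
    exact max_eq_left (div_nonneg (by linarith) hg.le)
  refine ⟨key, hcp, ?_⟩
  rw [key, hVtop p ⟨h0, h1⟩, max_eq_left (by linarith)]
end

section
/- Let p ∈ [0,1] satisfy N·p/(N+1) ≤ c < (N·p + 1)/(N+1). Then V(N, p) = max{ (p − c)·(1 + γ·p/(1 − γ)) + γ·p·(1 − p)/((1 − γ)·(N+1)) , 0 }, and moreover the identity (p − c)·(1 + γ·p/(1 − γ)) + γ·p·(1 − p)/((1 − γ)·(N+1)) − (p − c)/(1 − γ) = (γ·(1 − p)/(1 − γ))·(c − p + p/(N+1)) holds, the right-hand side being nonnegative; consequently V(N, p) ≥ V(N+1, p). -/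
/-- Base case, middle regime: if `p ∈ [0,1]` and `N·p/(N+1) ≤ c < (N·p+1)/(N+1)`, then
`V(N,p) = max{(p−c)(1 + γp/(1−γ)) + γp(1−p)/((1−γ)(N+1)), 0}`, the stated identity holds
with nonnegative right-hand side, and consequently `V(N,p) ≥ V(N+1,p)`. -/
theorem base_case_middle (c γ : ℝ) (hc0 : 0 < c) (hc1 : c < 1) (hγ0 : 0 < γ) (hγ1 : γ < 1)
    (N : ℕ) (hN : 1 ≤ N) (V : ℕ → ℝ → ℝ)
    (hVtop : ∀ p ∈ Set.Icc (0:ℝ) 1, V (N + 1) p = max (p - c) 0 / (1 - γ))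
    (hVrec : ∀ n : ℕ, 1 ≤ n → n ≤ N → ∀ p ∈ Set.Icc (0:ℝ) 1,
      V n p = max (p - c +
        γ * (p * V (n + 1) (((n : ℝ) * p + 1) / ((n : ℝ) + 1)) +
             (1 - p) * V (n + 1) ((n : ℝ) * p / ((n : ℝ) + 1)))) 0)
    (p : ℝ) (hp : p ∈ Set.Icc (0:ℝ) 1)
    (hlo : (N : ℝ) * p / ((N : ℝ) + 1) ≤ c)
    (hhi : c < ((N : ℝ) * p + 1) / ((N : ℝ) + 1)) :
    V N p = max ((p - c) * (1 + γ * p / (1 - γ)) +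
        γ * p * (1 - p) / ((1 - γ) * ((N : ℝ) + 1))) 0 ∧
    (p - c) * (1 + γ * p / (1 - γ)) + γ * p * (1 - p) / ((1 - γ) * ((N : ℝ) + 1)) -
        (p - c) / (1 - γ) =
      γ * (1 - p) / (1 - γ) * (c - p + p / ((N : ℝ) + 1)) ∧
    0 ≤ γ * (1 - p) / (1 - γ) * (c - p + p / ((N : ℝ) + 1)) ∧
    V N p ≥ V (N + 1) p := by
  obtain ⟨hp0, hp1⟩ := hp
  have hg : 0 < 1 - γ := by linarith
  have hg' : 1 - γ ≠ 0 := hg.ne'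
  have hM : (0:ℝ) < (N : ℝ) + 1 := by positivity
  have hM' : (N : ℝ) + 1 ≠ 0 := hM.ne'
  have hN0 : (0:ℝ) ≤ (N : ℝ) := by positivity
  have hNp : (N : ℝ) * p ≤ N := by nlinarith
  have hNp0 : 0 ≤ (N : ℝ) * p := by positivity
  have m1 : ((N : ℝ) * p + 1) / ((N : ℝ) + 1) ∈ Set.Icc (0:ℝ) 1 :=
    ⟨by positivity, by rw [div_le_one hM]; linarith⟩
  have m2 : (N : ℝ) * p / ((N : ℝ) + 1) ∈ Set.Icc (0:ℝ) 1 :=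
    ⟨by positivity, by rw [div_le_one hM]; linarith⟩
  have h1 : V N p = max ((p - c) * (1 + γ * p / (1 - γ)) +
        γ * p * (1 - p) / ((1 - γ) * ((N : ℝ) + 1))) 0 := by
    rw [hVrec N hN le_rfl p ⟨hp0, hp1⟩, hVtop _ m1, hVtop _ m2,
      max_eq_left (sub_nonneg.2 hhi.le), max_eq_right (sub_nonpos.2 hlo)]
    congr 1
    field_simp
    ring
  have h2 : (p - c) * (1 + γ * p / (1 - γ)) + γ * p * (1 - p) / ((1 - γ) * ((N : ℝ) + 1)) -
        (p - c) / (1 - γ) =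
      γ * (1 - p) / (1 - γ) * (c - p + p / ((N : ℝ) + 1)) := by
    field_simp
    ring
  have h3 : 0 ≤ γ * (1 - p) / (1 - γ) * (c - p + p / ((N : ℝ) + 1)) := by
    have e : c - p + p / ((N : ℝ) + 1) = c - (N : ℝ) * p / ((N : ℝ) + 1) := by
      field_simp
      ring
    rw [e]
    exact mul_nonneg (div_nonneg (mul_nonneg hγ0.le (by linarith)) hg.le) (by linarith)
  refine ⟨h1, h2, h3, ?_⟩
  rw [h1, hVtop p ⟨hp0, hp1⟩, ge_iff_le]
  rcases le_total (p - c) 0 with h | h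
  · rw [max_eq_right h, zero_div]
    exact le_max_right _ _
  · rw [max_eq_left h]
    exact le_trans (by linarith) (le_max_left _ _)
end

section
/- For each n with 1 ≤ n ≤ N+1, define the stopping set S(n) = {p ∈ [0,1] : V(n, p) = 0}. Then: (i) 0 ∈ S(n); (ii) S(n) is downward closed in [0,1], i.e. if 0 ≤ p₁ ≤ p₂ ≤ 1 and p₂ ∈ S(n) then p₁ ∈ S(n); (iii) S(n) ⊆ S(n+1) for 1 ≤ n ≤ N; and (iv) S(n) ⊆ [0, c], i.e. every p ∈ S(n) satisfies p ≤ c. Hence the stopping sets are nested intervals [0, c_n] with thresholds c_n ≤ c_{n+1} ≤ … ≤ c. -/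
/-- Expected value of `f` at the updated belief, with step size `s`. -/
noncomputable def stepE (s : ℝ) (f : ℝ → ℝ) (p : ℝ) : ℝ :=
  p * f ((1 - s) * p + s) + (1 - p) * f ((1 - s) * p)

lemma up_mem {s p : ℝ} (hs : s ∈ Set.Icc (0:ℝ) 1) (hp : p ∈ Set.Icc (0:ℝ) 1) :
    (1 - s) * p + s ∈ Set.Icc (0:ℝ) 1 := by
  obtain ⟨h1, h2⟩ := hs
  obtain ⟨h3, h4⟩ := hp
  constructor <;> nlinarith [mul_nonneg (sub_nonneg.2 h2) h3,
    mul_nonneg (sub_nonneg.2 h2) (sub_nonneg.2 h4)]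

lemma dn_mem {s p : ℝ} (hs : s ∈ Set.Icc (0:ℝ) 1) (hp : p ∈ Set.Icc (0:ℝ) 1) :
    (1 - s) * p ∈ Set.Icc (0:ℝ) 1 := by
  obtain ⟨h1, h2⟩ := hs
  obtain ⟨h3, h4⟩ := hp
  constructor <;> nlinarith [mul_nonneg (sub_nonneg.2 h2) h3, mul_nonneg h1 h3]

lemma four_point {f : ℝ → ℝ} (hf : ConvexOn ℝ (Set.Icc (0:ℝ) 1) f) {u v h : ℝ}
    (hu : u ∈ Set.Icc (0:ℝ) 1) (hv : v + h ∈ Set.Icc (0:ℝ) 1) (huv : u ≤ v) (hh : 0 ≤ h) :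
    f (u + h) + f v ≤ f u + f (v + h) := by
  rcases eq_or_lt_of_le (show (0:ℝ) ≤ v + h - u by linarith) with h0 | h0
  · have h1 : h = 0 := by linarith
    subst h1
    have h2 : u = v := by linarith
    subst h2
    simp
  · have key1 := hf.2 hu hv (show 0 ≤ (v - u) / (v + h - u) by
      apply div_nonneg <;> linarith) (show 0 ≤ h / (v + h - u) by
      apply div_nonneg <;> linarith) (by field_simp; ring)
    have key2 := hf.2 hu hv (show 0 ≤ h / (v + h - u) by
      apply div_nonneg <;> linarith) (show 0 ≤ (v - u) / (v + h - u) by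
      apply div_nonneg <;> linarith) (by field_simp; ring)
    simp only [smul_eq_mul] at key1 key2
    have e1 : (v - u) / (v + h - u) * u + h / (v + h - u) * (v + h) = u + h := by
      field_simp; ring
    have e2 : h / (v + h - u) * u + (v - u) / (v + h - u) * (v + h) = v := by
      field_simp; ring
    have e3 : h / (v + h - u) = 1 - (v - u) / (v + h - u) := by
      field_simp; ring
    rw [e1] at key1
    rw [e2] at key2
    rw [e3] at key1 key2
    linarith

lemma stepE_nonneg {s p : ℝ} {f : ℝ → ℝ} (hs : s ∈ Set.Icc (0:ℝ) 1)
    (hp : p ∈ Set.Icc (0:ℝ) 1) (h0 : ∀ x ∈ Set.Icc (0:ℝ) 1, 0 ≤ f x) : 0 ≤ stepE s f p :=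
  add_nonneg (mul_nonneg hp.1 (h0 _ (up_mem hs hp)))
    (mul_nonneg (sub_nonneg.2 hp.2) (h0 _ (dn_mem hs hp)))

lemma stepE_le {s p : ℝ} {f g : ℝ → ℝ} (hs : s ∈ Set.Icc (0:ℝ) 1)
    (hp : p ∈ Set.Icc (0:ℝ) 1) (h0 : ∀ x ∈ Set.Icc (0:ℝ) 1, f x ≤ g x) :
    stepE s f p ≤ stepE s g p :=
  add_le_add (mul_le_mul_of_nonneg_left (h0 _ (up_mem hs hp)) hp.1)
    (mul_le_mul_of_nonneg_left (h0 _ (dn_mem hs hp)) (sub_nonneg.2 hp.2))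

lemma stepE_mono {s : ℝ} {f : ℝ → ℝ} (hs : s ∈ Set.Icc (0:ℝ) 1)
    (hf : MonotoneOn f (Set.Icc (0:ℝ) 1)) : MonotoneOn (stepE s f) (Set.Icc (0:ℝ) 1) := by
  intro x hx y hy hxy
  have hs' : 0 ≤ 1 - s := sub_nonneg.2 hs.2
  have hm : (1 - s) * x ≤ (1 - s) * y := mul_le_mul_of_nonneg_left hxy hs'
  have a1 := hf (up_mem hs hx) (up_mem hs hy) (by linarith)
  have a2 := hf (dn_mem hs hx) (dn_mem hs hy) hm
  have a3 := hf (dn_mem hs hx) (up_mem hs hx) (by linarith [hs.1])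
  unfold stepE
  nlinarith [mul_le_mul_of_nonneg_left a1 hy.1,
    mul_le_mul_of_nonneg_left a2 (sub_nonneg.2 hy.2),
    mul_le_mul_of_nonneg_left a3 (sub_nonneg.2 hxy)]

lemma stepE_convex {s : ℝ} {f : ℝ → ℝ} (hs : s ∈ Set.Icc (0:ℝ) 1)
    (hf : ConvexOn ℝ (Set.Icc (0:ℝ) 1) f) : ConvexOn ℝ (Set.Icc (0:ℝ) 1) (stepE s f) := by
  refine LinearOrder.convexOn_of_lt (convex_Icc 0 1) ?_
  intro x hx y hy hxy a b ha hb hab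
  have hs' : 0 ≤ 1 - s := sub_nonneg.2 hs.2
  have hm : (1 - s) * x ≤ (1 - s) * y := mul_le_mul_of_nonneg_left hxy.le hs'
  have hz : a * x + b * y ∈ Set.Icc (0:ℝ) 1 := (convex_Icc (0:ℝ) 1) hx hy ha.le hb.le hab
  have k1 := hf.2 (up_mem hs hx) (up_mem hs hy) ha.le hb.le hab
  have k2 := hf.2 (dn_mem hs hx) (dn_mem hs hy) ha.le hb.le hab
  have k3 := four_point hf (dn_mem hs hx) (up_mem hs hy) hm hs.1
  simp only [smul_eq_mul] at *
  have hb' : b = 1 - a := by linarith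
  have e1 : a * ((1 - s) * x + s) + b * ((1 - s) * y + s) = (1 - s) * (a * x + b * y) + s := by
    subst hb'; ring
  have e2 : a * ((1 - s) * x) + b * ((1 - s) * y) = (1 - s) * (a * x + b * y) := by ring
  rw [e1] at k1
  rw [e2] at k2
  unfold stepE
  have m1 := mul_le_mul_of_nonneg_left k1 hz.1
  have m2 := mul_le_mul_of_nonneg_left k2 (sub_nonneg.2 hz.2)
  have m3 := mul_le_mul_of_nonneg_left k3
    (mul_nonneg (mul_nonneg ha.le hb.le) (sub_nonneg.2 hxy.le))
  refine (add_le_add m1 m2).trans ?_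
  subst hb'
  linarith

lemma le_stepE {s p : ℝ} {f : ℝ → ℝ} (hs : s ∈ Set.Icc (0:ℝ) 1)
    (hp : p ∈ Set.Icc (0:ℝ) 1) (hf : ConvexOn ℝ (Set.Icc (0:ℝ) 1) f) : f p ≤ stepE s f p := by
  have k := hf.2 (up_mem hs hp) (dn_mem hs hp) hp.1 (sub_nonneg.2 hp.2) (by ring)
  simp only [smul_eq_mul] at k
  have e : p * ((1 - s) * p + s) + (1 - p) * ((1 - s) * p) = p := by ring
  rw [e] at k
  exact k

lemma stepE_shrink {s t p : ℝ} {f : ℝ → ℝ} (hs : s ∈ Set.Icc (0:ℝ) 1)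
    (ht : t ∈ Set.Icc (0:ℝ) 1)
    (hp : p ∈ Set.Icc (0:ℝ) 1) (hf : ConvexOn ℝ (Set.Icc (0:ℝ) 1) f) :
    stepE (t * s) f p ≤ stepE s f p := by
  have k0 := le_stepE hs hp hf
  have k1 := hf.2 (up_mem hs hp) hp ht.1 (sub_nonneg.2 ht.2) (by ring)
  have k2 := hf.2 (dn_mem hs hp) hp ht.1 (sub_nonneg.2 ht.2) (by ring)
  simp only [smul_eq_mul] at k1 k2
  have e1 : t * ((1 - s) * p + s) + (1 - t) * p = (1 - t * s) * p + t * s := by ring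
  have e2 : t * ((1 - s) * p) + (1 - t) * p = (1 - t * s) * p := by ring
  rw [e1] at k1
  rw [e2] at k2
  have m1 := mul_le_mul_of_nonneg_left k1 hp.1
  have m2 := mul_le_mul_of_nonneg_left k2 (sub_nonneg.2 hp.2)
  have m3 := mul_le_mul_of_nonneg_left k0 (sub_nonneg.2 ht.2)
  unfold stepE at *
  linarith

lemma convexOn_congr' {f g : ℝ → ℝ} (hf : ConvexOn ℝ (Set.Icc (0:ℝ) 1) f)
    (h : ∀ x ∈ Set.Icc (0:ℝ) 1, g x = f x) : ConvexOn ℝ (Set.Icc (0:ℝ) 1) g :=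
  hf.congr (fun x hx => (h x hx).symm)

lemma inv_mem (n : ℕ) : 1 / ((n:ℝ) + 1) ∈ Set.Icc (0:ℝ) 1 := by
  constructor
  · positivity
  · rw [div_le_one (by positivity)]
    have : (0:ℝ) ≤ n := Nat.cast_nonneg n
    linarith


/-- Stopping sets: with `S(n) = {p ∈ [0,1] : V(n,p) = 0}`, one has (i) `0 ∈ S(n)`;
(ii) `S(n)` is downward closed in `[0,1]`; (iii) `S(n) ⊆ S(n+1)` for `1 ≤ n ≤ N`;
(iv) every `p ∈ S(n)` satisfies `p ≤ c`. -/
theorem stopping_sets_nested (c γ : ℝ) (hc0 : 0 < c) (hc1 : c < 1) (hγ0 : 0 < γ) (hγ1 : γ < 1)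
    (N : ℕ) (hN : 1 ≤ N) (V : ℕ → ℝ → ℝ)
    (hVtop : ∀ p ∈ Set.Icc (0:ℝ) 1, V (N + 1) p = max (p - c) 0 / (1 - γ))
    (hVrec : ∀ n : ℕ, 1 ≤ n → n ≤ N → ∀ p ∈ Set.Icc (0:ℝ) 1,
      V n p = max (p - c +
        γ * (p * V (n + 1) (((n : ℝ) * p + 1) / ((n : ℝ) + 1)) +
             (1 - p) * V (n + 1) ((n : ℝ) * p / ((n : ℝ) + 1)))) 0) :
    ∀ S : ℕ → Set ℝ,
      (∀ n : ℕ, S n = {p : ℝ | p ∈ Set.Icc (0:ℝ) 1 ∧ V n p = 0}) →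
      ∀ n : ℕ, 1 ≤ n → n ≤ N + 1 →
        (0 : ℝ) ∈ S n ∧
        (∀ p₁ p₂ : ℝ, 0 ≤ p₁ → p₁ ≤ p₂ → p₂ ≤ 1 → p₂ ∈ S n → p₁ ∈ S n) ∧
        (n ≤ N → S n ⊆ S (n + 1)) ∧
        (∀ p ∈ S n, p ≤ c) := by

  have h1γ : 0 < 1 - γ := by linarith
  have hrec : ∀ n : ℕ, 1 ≤ n → n ≤ N → ∀ p ∈ Set.Icc (0:ℝ) 1,
      V n p = max (p - c + γ * stepE (1 / ((n:ℝ) + 1)) (V (n + 1)) p) 0 := by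
    intro n h1 h2 p hp
    have hn : (n:ℝ) + 1 ≠ 0 := by positivity
    rw [hVrec n h1 h2 p hp]
    unfold stepE
    have e1 : (1 - 1 / ((n:ℝ) + 1)) * p + 1 / ((n:ℝ) + 1) = ((n : ℝ) * p + 1) / ((n : ℝ) + 1) := by
      field_simp; ring
    have e2 : (1 - 1 / ((n:ℝ) + 1)) * p = (n : ℝ) * p / ((n : ℝ) + 1) := by
      field_simp; ring
    rw [e1, e2]
  have hlinc : ConvexOn ℝ (Set.Icc (0:ℝ) 1) (fun p : ℝ => p - c) :=
    (convexOn_id (convex_Icc 0 1)).sub (concaveOn_const c (convex_Icc 0 1))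
  have hzero : ConvexOn ℝ (Set.Icc (0:ℝ) 1) (fun _ : ℝ => (0:ℝ)) :=
    convexOn_const 0 (convex_Icc 0 1)
  -- structural properties
  have main : ∀ k n : ℕ, n + k = N + 1 → 1 ≤ n →
      (∀ p ∈ Set.Icc (0:ℝ) 1, 0 ≤ V n p) ∧ V n 0 = 0 ∧
      MonotoneOn (V n) (Set.Icc (0:ℝ) 1) ∧ ConvexOn ℝ (Set.Icc (0:ℝ) 1) (V n) := by
    intro k
    induction k with
    | zero =>
      intro n hn h1
      have : n = N + 1 := by omega
      subst this
      refine ⟨?_, ?_, ?_, ?_⟩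
      · intro p hp
        rw [hVtop p hp]
        exact div_nonneg (le_max_right _ _) h1γ.le
      · rw [hVtop 0 (by simp), max_eq_right (by linarith)]
        simp
      · intro x hx y hy hxy
        rw [hVtop x hx, hVtop y hy]
        gcongr
      · refine convexOn_congr' ((hlinc.sup hzero).smul (inv_nonneg.2 h1γ.le)) ?_
        intro x hx
        rw [hVtop x hx]
        simp [div_eq_inv_mul]
    | succ k ih =>
      intro n hn h1
      obtain ⟨i1, i2, i3, i4⟩ := ih (n + 1) (by omega) (by omega)
      have hr := hrec n h1 (by omega)
      have hs := inv_mem n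
      refine ⟨?_, ?_, ?_, ?_⟩
      · intro p hp
        rw [hr p hp]
        exact le_max_right _ _
      · rw [hr 0 (by simp)]
        simp [stepE, i2, hc0.le]
      · intro x hx y hy hxy
        rw [hr x hx, hr y hy]
        have := stepE_mono hs i3 hx hy hxy
        gcongr
      · refine convexOn_congr'
          ((hlinc.add ((stepE_convex hs i4).smul hγ0.le)).sup hzero) ?_
        intro x hx
        rw [hr x hx]
        simp
  have dec : ∀ k n : ℕ, n + k = N → 1 ≤ n →
      ∀ p ∈ Set.Icc (0:ℝ) 1, V (n + 1) p ≤ V n p := by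
    intro k
    induction k with
    | zero =>
      intro n hn h1 p hp
      have : n = N := by omega
      subst this
      obtain ⟨i1, i2, i3, i4⟩ := main 0 (n + 1) (by omega) (by omega)
      have hle := le_stepE (inv_mem n) hp i4
      rw [hrec n h1 le_rfl p hp]
      rcases le_total p c with hpc | hpc
      · rw [hVtop p hp, max_eq_right (by linarith)]
        simp
      · refine le_trans ?_ (le_max_left _ _)
        have hm := mul_le_mul_of_nonneg_left hle hγ0.le
        have e : V (n + 1) p = p - c + γ * V (n + 1) p := by
          rw [hVtop p hp, max_eq_left (by linarith)]
          field_simp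
          ring
        linarith
    | succ k ih =>
      intro n hn h1 p hp
      obtain ⟨i1, i2, i3, i4⟩ := main (k + 1) (n + 1) (by omega) (by omega)
      obtain ⟨j1, j2, j3, j4⟩ := main k (n + 2) (by omega) (by omega)
      have d := ih (n + 1) (by omega) (by omega)
      rw [hrec n h1 (by omega) p hp, hrec (n + 1) (by omega) (by omega) p hp]
      have ht : ((n:ℝ) + 1) / ((n:ℝ) + 2) ∈ Set.Icc (0:ℝ) 1 := by
        constructor
        · positivity
        · rw [div_le_one (by positivity)]
          linarith
      have a1 := stepE_shrink (inv_mem n) ht hp i4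
      have a2 := stepE_le (inv_mem (n + 1)) hp d
      have e : ((n:ℝ) + 1) / ((n:ℝ) + 2) * (1 / ((n:ℝ) + 1)) = 1 / (((n + 1 : ℕ) : ℝ) + 1) := by
        push_cast
        field_simp
        ring
      rw [e] at a1
      have a3 := a2.trans a1
      gcongr
  intro S hS n h1 h2
  obtain ⟨i1, i2, i3, i4⟩ := main (N + 1 - n) n (by omega) h1
  simp only [hS]
  refine ⟨⟨by simp, i2⟩, ?_, ?_, ?_⟩
  · rintro p q hp hpq hq ⟨hq1, hq2⟩
    have hpm : p ∈ Set.Icc (0:ℝ) 1 := ⟨hp, hpq.trans hq⟩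
    exact ⟨hpm, le_antisymm (hq2 ▸ i3 hpm hq1 hpq) (i1 p hpm)⟩
  · rintro hn p ⟨hp, hp0⟩
    obtain ⟨j1, -⟩ := main (N - n) (n + 1) (by omega) (by omega)
    exact ⟨hp, le_antisymm (hp0 ▸ dec (N - n) n (by omega) h1 p hp) (j1 p hp)⟩
  · rintro p ⟨hp, hp0⟩
    rcases Nat.lt_or_ge N n with hn | hn
    · have : n = N + 1 := by omega
      subst this
      rw [hVtop p hp, div_eq_zero_iff] at hp0
      rcases hp0 with h | h
      · have := le_max_left (p - c) 0
        linarith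
      · linarith
    · obtain ⟨j1, -⟩ := main (N - n) (n + 1) (by omega) (by omega)
      have hnn := stepE_nonneg (inv_mem n) hp j1
      rw [hrec n h1 hn p hp] at hp0
      have := le_max_left (p - c + γ * stepE (1 / ((n:ℝ) + 1)) (V (n + 1)) p) 0
      have := mul_nonneg hγ0.le hnn
      linarith
end

section
/- For every n with 1 ≤ n ≤ N+1, the function p ↦ W(n, p) is convex on [0,1]; that is, for all p₁, p₂ ∈ [0,1] and α ∈ [0,1], W(n, α·p₁ + (1−α)·p₂) ≤ α·W(n, p₁) + (1−α)·W(n, p₂). -/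
/-- Convexity on the unit interval, elementary form. -/
def Cvx01 (f : ℝ → ℝ) : Prop :=
  ∀ p₁ ∈ Set.Icc (0:ℝ) 1, ∀ p₂ ∈ Set.Icc (0:ℝ) 1, ∀ α : ℝ, 0 ≤ α → α ≤ 1 →
    f (α * p₁ + (1 - α) * p₂) ≤ α * f p₁ + (1 - α) * f p₂

/-- Increments of a convex function are monotone. -/
lemma Cvx01.incr {f : ℝ → ℝ} (hf : Cvx01 f) {x y h : ℝ} (hx : 0 ≤ x) (hxy : x ≤ y)
    (hh : 0 < h) (hy : y + h ≤ 1) : f (x + h) - f x ≤ f (y + h) - f y := by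
  have hd : 0 < y + h - x := by linarith
  have ht0 : 0 ≤ h / (y + h - x) := by positivity
  have ht1 : h / (y + h - x) ≤ 1 := by rw [div_le_one hd]; linarith
  have hte : h / (y + h - x) * (y + h - x) = h := div_mul_cancel₀ _ hd.ne'
  generalize h / (y + h - x) = t at *
  have mx : x ∈ Set.Icc (0:ℝ) 1 := ⟨hx, by linarith⟩
  have my : y + h ∈ Set.Icc (0:ℝ) 1 := ⟨by linarith, hy⟩
  have h1 := hf (y + h) my x mx t ht0 ht1
  have h2 := hf x mx (y + h) my t ht0 ht1
  rw [show t * (y + h) + (1 - t) * x = x + h by linarith] at h1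
  rw [show t * x + (1 - t) * (y + h) = y by linarith] at h2
  linarith

/-- One step of the backward recursion preserves convexity. -/
lemma Cvx01.step {f g : ℝ → ℝ} (hf : Cvx01 f) (n : ℕ)
    (hg : ∀ p ∈ Set.Icc (0:ℝ) 1, g p = p * f (((n : ℝ) * p + 1) / ((n : ℝ) + 1)) +
        (1 - p) * f ((n : ℝ) * p / ((n : ℝ) + 1))) : Cvx01 g := by
  intro p hp q hq α h0 h1
  have hn : (0:ℝ) ≤ n := Nat.cast_nonneg n
  have hn1 : (0:ℝ) < (n:ℝ) + 1 := by linarith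
  have hr : α * p + (1 - α) * q ∈ Set.Icc (0:ℝ) 1 :=
    ⟨by nlinarith [hp.1, hq.1, mul_nonneg h0 hp.1, mul_nonneg (sub_nonneg.2 h1) hq.1],
      by nlinarith [mul_nonneg h0 (sub_nonneg.2 hp.2),
        mul_nonneg (sub_nonneg.2 h1) (sub_nonneg.2 hq.2)]⟩
  have mA : ∀ x ∈ Set.Icc (0:ℝ) 1, ((n:ℝ) * x + 1) / ((n:ℝ) + 1) ∈ Set.Icc (0:ℝ) 1 := by
    intro x hx
    have := mul_nonneg hn hx.1
    have := mul_nonneg hn (sub_nonneg.2 hx.2)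
    exact ⟨by positivity, by rw [div_le_one hn1]; linarith⟩
  have mB : ∀ x ∈ Set.Icc (0:ℝ) 1, (n:ℝ) * x / ((n:ℝ) + 1) ∈ Set.Icc (0:ℝ) 1 := by
    intro x hx
    have := mul_nonneg hn hx.1
    have := mul_nonneg hn (sub_nonneg.2 hx.2)
    exact ⟨by positivity, by rw [div_le_one hn1]; linarith⟩
  have hA := hf _ (mA p hp) _ (mA q hq) α h0 h1
  have hB := hf _ (mB p hp) _ (mB q hq) α h0 h1
  rw [show α * (((n:ℝ) * p + 1) / ((n:ℝ) + 1)) + (1 - α) * (((n:ℝ) * q + 1) / ((n:ℝ) + 1))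
    = ((n:ℝ) * (α * p + (1 - α) * q) + 1) / ((n:ℝ) + 1) by field_simp; ring] at hA
  rw [show α * ((n:ℝ) * p / ((n:ℝ) + 1)) + (1 - α) * ((n:ℝ) * q / ((n:ℝ) + 1))
    = (n:ℝ) * (α * p + (1 - α) * q) / ((n:ℝ) + 1) by field_simp] at hB
  have mono : ∀ x ∈ Set.Icc (0:ℝ) 1, ∀ y ∈ Set.Icc (0:ℝ) 1, x ≤ y →
      f (((n:ℝ) * x + 1) / ((n:ℝ) + 1)) - f ((n:ℝ) * x / ((n:ℝ) + 1)) ≤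
      f (((n:ℝ) * y + 1) / ((n:ℝ) + 1)) - f ((n:ℝ) * y / ((n:ℝ) + 1)) := by
    intro x hx y hy hxy
    have e : ∀ z : ℝ, ((n:ℝ) * z + 1) / ((n:ℝ) + 1)
        = (n:ℝ) * z / ((n:ℝ) + 1) + 1 / ((n:ℝ) + 1) := fun z => add_div _ _ _
    have hle := (mA y hy).2
    rw [e] at hle
    rw [e, e]
    exact hf.incr (mB x hx).1 (by gcongr) (by positivity) hle
  have key : 0 ≤ (p - q) *
      ((f (((n:ℝ) * p + 1) / ((n:ℝ) + 1)) - f ((n:ℝ) * p / ((n:ℝ) + 1))) -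
      (f (((n:ℝ) * q + 1) / ((n:ℝ) + 1)) - f ((n:ℝ) * q / ((n:ℝ) + 1)))) := by
    rcases le_total p q with h | h
    · exact mul_nonneg_of_nonpos_of_nonpos (by linarith) (by linarith [mono p hp q hq h])
    · exact mul_nonneg (by linarith) (by linarith [mono q hq p hp h])
  have k1 := mul_nonneg (mul_nonneg h0 (sub_nonneg.2 h1)) key
  have k2 := mul_le_mul_of_nonneg_left hA hr.1
  have k3 := mul_le_mul_of_nonneg_left hB (sub_nonneg.2 hr.2)
  rw [hg _ hr, hg p hp, hg q hq]
  refine (add_le_add k2 k3).trans ?_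
  linarith

/-- Average-reward value function: for every `1 ≤ n ≤ N+1`,
the function `p ↦ W(n,p)` is convex on `[0,1]`. -/
theorem avg_value_convex (c : ℝ) (hc0 : 0 < c) (hc1 : c < 1)
    (N : ℕ) (hN : 1 ≤ N) (W : ℕ → ℝ → ℝ)
    (hWtop : ∀ p ∈ Set.Icc (0:ℝ) 1, W (N + 1) p = max (p - c) 0)
    (hWrec : ∀ n : ℕ, 1 ≤ n → n ≤ N → ∀ p ∈ Set.Icc (0:ℝ) 1,
      W n p = p * W (n + 1) (((n : ℝ) * p + 1) / ((n : ℝ) + 1)) +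
        (1 - p) * W (n + 1) ((n : ℝ) * p / ((n : ℝ) + 1)))
    (n : ℕ) (hn1 : 1 ≤ n) (hnN : n ≤ N + 1)
    (p₁ p₂ : ℝ) (hp₁ : p₁ ∈ Set.Icc (0:ℝ) 1) (hp₂ : p₂ ∈ Set.Icc (0:ℝ) 1)
    (α : ℝ) (hα0 : 0 ≤ α) (hα1 : α ≤ 1) :
    W n (α * p₁ + (1 - α) * p₂) ≤ α * W n p₁ + (1 - α) * W n p₂ := by
  have main : ∀ k m : ℕ, 1 ≤ m → m + k = N + 1 → Cvx01 (W m) := by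
    intro k
    induction k with
    | zero =>
      intro m _ hm p hp q hq a h0 h1
      obtain rfl : m = N + 1 := by omega
      have hr : a * p + (1 - a) * q ∈ Set.Icc (0:ℝ) 1 :=
        ⟨by linarith [mul_nonneg h0 hp.1, mul_nonneg (sub_nonneg.2 h1) hq.1],
          by linarith [mul_nonneg h0 (sub_nonneg.2 hp.2),
            mul_nonneg (sub_nonneg.2 h1) (sub_nonneg.2 hq.2)]⟩
      rw [hWtop _ hr, hWtop p hp, hWtop q hq]
      have a1 := mul_le_mul_of_nonneg_left (le_max_left (p - c) 0) h0
      have a2 := mul_le_mul_of_nonneg_left (le_max_right (p - c) 0) h0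
      have b1 := mul_le_mul_of_nonneg_left (le_max_left (q - c) 0) (sub_nonneg.2 h1)
      have b2 := mul_le_mul_of_nonneg_left (le_max_right (q - c) 0) (sub_nonneg.2 h1)
      exact max_le (by linarith) (by linarith)
    | succ k ih =>
      intro m hm1 hm
      exact (ih (m + 1) (by omega) (by omega)).step m (hWrec m hm1 (by omega))
  exact main (N + 1 - n) n hn1 (by omega) p₁ hp₁ p₂ hp₂ α hα0 hα1
end

section
/- For every n with 1 ≤ n ≤ N and every p ∈ [0,1], W(n, p) ≥ W(n+1, p); and consequently, for every n with 1 ≤ n ≤ N+1 and every p ∈ [0,1], W(n, p) ≥ max{p − c, 0} ≥ 0. In particular, the value of continuing (accepting with positive probability) is nonnegative in every belief state, so it is always at least as good as the stopping action whose value is 0. -/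
/-- Increments of a convex function on `[0,1]` are monotone. -/
lemma convex_incr (f : ℝ → ℝ) (hf : ConvexOn ℝ (Set.Icc (0:ℝ) 1) f) (x y b : ℝ)
    (hx : 0 ≤ x) (hxy : x ≤ y) (hb : 0 < b) (hy : y + b ≤ 1) :
    f (x + b) + f y ≤ f x + f (y + b) := by
  have hL : 0 < y - x + b := by linarith
  have hl0 : 0 ≤ b / (y - x + b) := by positivity
  have hl1 : 0 ≤ (y - x) / (y - x + b) := div_nonneg (by linarith) hL.le
  have hs : b / (y - x + b) + (y - x) / (y - x + b) = 1 := by field_simp; ring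
  have mx : x ∈ Set.Icc (0:ℝ) 1 := ⟨hx, by linarith⟩
  have my : y + b ∈ Set.Icc (0:ℝ) 1 := ⟨by linarith, hy⟩
  have h1 := hf.2 mx my hl0 hl1 hs
  have h2 := hf.2 mx my hl1 hl0 (by linarith)
  simp only [smul_eq_mul] at h1 h2
  have e1 : b / (y - x + b) * x + (y - x) / (y - x + b) * (y + b) = y := by
    field_simp; ring
  have e2 : (y - x) / (y - x + b) * x + b / (y - x + b) * (y + b) = x + b := by
    field_simp; ring
  rw [e1] at h1
  rw [e2] at h2
  have hs' : (y - x) / (y - x + b) = 1 - b / (y - x + b) := by linarith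
  rw [hs'] at h1 h2
  linarith

/-- The Bernoulli averaging operator preserves convexity. -/
lemma convex_step (f g : ℝ → ℝ) (a b : ℝ) (ha : 0 ≤ a) (hb : 0 < b) (hab : a + b = 1)
    (hf : ConvexOn ℝ (Set.Icc (0:ℝ) 1) f)
    (hg : ∀ p ∈ Set.Icc (0:ℝ) 1, g p = p * f (a * p + b) + (1 - p) * f (a * p)) :
    ConvexOn ℝ (Set.Icc (0:ℝ) 1) g := by
  refine ⟨convex_Icc 0 1, ?_⟩
  intro x hx y hy s t hs ht hst
  have hz : s • x + t • y ∈ Set.Icc (0:ℝ) 1 := convex_Icc 0 1 hx hy hs ht hst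
  have mu : ∀ p ∈ Set.Icc (0:ℝ) 1, a * p + b ∈ Set.Icc (0:ℝ) 1 := fun p hp =>
    ⟨by have := mul_nonneg ha hp.1; linarith, by nlinarith [hp.2]⟩
  have mv : ∀ p ∈ Set.Icc (0:ℝ) 1, a * p ∈ Set.Icc (0:ℝ) 1 := fun p hp =>
    ⟨mul_nonneg ha hp.1, by nlinarith [hp.2]⟩
  have h1 := hf.2 (mu x hx) (mu y hy) hs ht hst
  have h2 := hf.2 (mv x hx) (mv y hy) hs ht hst
  rw [hg _ hz, hg x hx, hg y hy]
  simp only [smul_eq_mul] at *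
  have e1 : s * (a * x + b) + t * (a * y + b) = a * (s * x + t * y) + b := by
    linear_combination b * hst
  have e2 : s * (a * x) + t * (a * y) = a * (s * x + t * y) := by ring
  rw [e1] at h1
  rw [e2] at h2
  have h3 := mul_le_mul_of_nonneg_left h1 hz.1
  have h4 := mul_le_mul_of_nonneg_left h2 (sub_nonneg.2 hz.2)
  have h5 : 0 ≤ (y - x) * ((f (a * y + b) - f (a * y)) - (f (a * x + b) - f (a * x))) := by
    rcases le_total x y with h | h
    · have := convex_incr f hf (a * x) (a * y) b (mv x hx).1
        (mul_le_mul_of_nonneg_left h ha) hb (mu y hy).2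
      exact mul_nonneg (by linarith) (by linarith)
    · have := convex_incr f hf (a * y) (a * x) b (mv y hy).1
        (mul_le_mul_of_nonneg_left h ha) hb (mu x hx).2
      exact mul_nonneg_of_nonpos_of_nonpos (by linarith) (by linarith)
  have h6 := mul_nonneg (mul_nonneg hs ht) h5
  obtain rfl : t = 1 - s := by linarith
  nlinarith [h3, h4, h6]

/-- Theorem 3 (average reward): `W(n,p) ≥ W(n+1,p)` for `1 ≤ n ≤ N`, and consequently
`W(n,p) ≥ max{p − c, 0} ≥ 0` for all `1 ≤ n ≤ N+1` and `p ∈ [0,1]`; continuing is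
always at least as good as stopping (whose value is 0). -/
theorem avg_value_nonneg (c : ℝ) (hc0 : 0 < c) (hc1 : c < 1)
    (N : ℕ) (hN : 1 ≤ N) (W : ℕ → ℝ → ℝ)
    (hWtop : ∀ p ∈ Set.Icc (0:ℝ) 1, W (N + 1) p = max (p - c) 0)
    (hWrec : ∀ n : ℕ, 1 ≤ n → n ≤ N → ∀ p ∈ Set.Icc (0:ℝ) 1,
      W n p = p * W (n + 1) (((n : ℝ) * p + 1) / ((n : ℝ) + 1)) +
        (1 - p) * W (n + 1) ((n : ℝ) * p / ((n : ℝ) + 1))) :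
    (∀ n : ℕ, 1 ≤ n → n ≤ N → ∀ p ∈ Set.Icc (0:ℝ) 1, W n p ≥ W (n + 1) p) ∧
    (∀ n : ℕ, 1 ≤ n → n ≤ N + 1 → ∀ p ∈ Set.Icc (0:ℝ) 1,
      W n p ≥ max (p - c) 0 ∧ max (p - c) 0 ≥ 0) := by
  have hrec : ∀ n : ℕ, 1 ≤ n → n ≤ N → ∀ p ∈ Set.Icc (0:ℝ) 1,
      W n p = p * W (n + 1) ((n : ℝ) / (n + 1) * p + 1 / ((n : ℝ) + 1)) +
        (1 - p) * W (n + 1) ((n : ℝ) / (n + 1) * p) := by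
    intro n h1 h2 p hp
    rw [hWrec n h1 h2 p hp]
    have e1 : ((n : ℝ) * p + 1) / ((n : ℝ) + 1)
      = (n : ℝ) / (n + 1) * p + 1 / ((n : ℝ) + 1) := by ring
    have e2 : (n : ℝ) * p / ((n : ℝ) + 1) = (n : ℝ) / (n + 1) * p := by ring
    rw [e1, e2]
  have hab : ∀ n : ℕ, (n : ℝ) / (n + 1) + 1 / ((n : ℝ) + 1) = 1 := by
    intro n
    field_simp
  have hconv : ∀ k n : ℕ, n + k = N + 1 → 1 ≤ n →
      ConvexOn ℝ (Set.Icc (0:ℝ) 1) (W n) := by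
    intro k
    induction k with
    | zero =>
      intro n hn _
      obtain rfl : n = N + 1 := by omega
      have h : ConvexOn ℝ (Set.Icc (0:ℝ) 1) (fun p : ℝ => max (p - c) 0) :=
        ((convexOn_id (convex_Icc 0 1)).sub (concaveOn_const c (convex_Icc 0 1))).sup
          (convexOn_const 0 (convex_Icc 0 1))
      exact h.congr fun p hp => (hWtop p hp).symm
    | succ k ih =>
      intro n hn h1
      exact convex_step (W (n + 1)) (W n) _ _ (by positivity) (by positivity) (hab n)
        (ih (n + 1) (by omega) (by omega)) (hrec n h1 (by omega))
  have hmono : ∀ n : ℕ, 1 ≤ n → n ≤ N → ∀ p ∈ Set.Icc (0:ℝ) 1, W n p ≥ W (n + 1) p := by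
    intro n h1 h2 p hp
    have hc := hconv (N - n) (n + 1) (by omega) (by omega)
    rw [hrec n h1 h2 p hp]
    have hab' := hab n
    have ha : 0 ≤ (n : ℝ) / (n + 1) := by positivity
    have hb : 0 < 1 / ((n : ℝ) + 1) := by positivity
    generalize (n : ℝ) / (n + 1) = a at *
    generalize 1 / ((n : ℝ) + 1) = b at *
    have hap := mul_nonneg ha hp.1
    have h := hc.2 (x := a * p + b) (y := a * p)
      ⟨by linarith, by nlinarith [hp.2]⟩ ⟨hap, by nlinarith [hp.2]⟩
      hp.1 (sub_nonneg.2 hp.2) (by ring)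
    simp only [smul_eq_mul] at h
    have e : p * (a * p + b) + (1 - p) * (a * p) = p := by linear_combination p * hab'
    rwa [e] at h
  refine ⟨hmono, ?_⟩
  have hge : ∀ k n : ℕ, n + k = N + 1 → 1 ≤ n → ∀ p ∈ Set.Icc (0:ℝ) 1,
      W n p ≥ max (p - c) 0 := by
    intro k
    induction k with
    | zero =>
      intro n hn _ p hp
      obtain rfl : n = N + 1 := by omega
      exact (hWtop p hp).ge
    | succ k ih =>
      intro n hn h1 p hp
      exact (ih (n + 1) (by omega) (by omega) p hp).trans (hmono n h1 (by omega) p hp)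
  intro n h1 h2 p hp
  exact ⟨hge (N + 1 - n) n (by omega) h1 p hp, le_max_right _ _⟩
end
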